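/- Let g ∈ ℝ[z_1,…,z_n] be a multi-affine real stable polynomial. Then g is the kernel polynomial of some strongly Rayleigh point process on [n] if and only if the coefficient of z_1⋯z_n in g equals 1 and all roots of the diagonalization ḡ lie in the interval [0,1]. -/

import Mathlib

open MvPolynomial Polynomial

/-- A polynomial with real coefficients is *real stable* if it does not vanish
when all variables have positive imaginary part. -/
def RealStable {n : ℕ} (p : MvPolynomial (Fin n) ℝ) : Prop :=
  ∀ z : Fin n → ℂ, (∀ i, 0 < (z i).im) →
    MvPolynomial.eval z (MvPolynomial.map (algebraMap ℝ ℂ) p) ≠ 0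

/-- A polynomial is *multi-affine* if it has degree at most 1 in each variable. -/
def MultiAffine {n : ℕ} (p : MvPolynomial (Fin n) ℝ) : Prop :=
  ∀ i, p.degreeOf i ≤ 1

/-- The diagonalization `p̄(x) = p(x,…,x)` of a multivariate polynomial. -/
noncomputable def diagPoly {n : ℕ} (p : MvPolynomial (Fin n) ℝ) : Polynomial ℝ :=
  MvPolynomial.aeval (fun _ => Polynomial.X) p

/-- The exponent of the multi-affine monomial `∏_{i ∈ A} z_i`. -/
noncomputable def expOf {n : ℕ} (A : Finset (Fin n)) : Fin n →₀ ℕ :=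
  ∑ i ∈ A, Finsupp.single i 1

/-- `∂^S p = (∏_{i ∈ S} ∂/∂z_i) p`. -/
noncomputable def pderivs {n : ℕ} (S : Finset (Fin n)) (p : MvPolynomial (Fin n) ℝ) :
    MvPolynomial (Fin n) ℝ :=
  S.toList.foldr (fun i q => MvPolynomial.pderiv i q) p

/-- `μ` is the law of a point process on `[n]`, i.e. a probability
distribution on subsets of `[n]`. -/
def IsPointProcess {n : ℕ} (μ : Finset (Fin n) → ℝ) : Prop :=
  (∀ A, 0 ≤ μ A) ∧ (∑ A : Finset (Fin n), μ A) = 1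

/-- The probability generating polynomial `f_𝔛(z) = Σ_A ℙ(𝔛 = A) z^A`. -/
noncomputable def genPoly {n : ℕ} (μ : Finset (Fin n) → ℝ) : MvPolynomial (Fin n) ℝ :=
  ∑ A : Finset (Fin n), MvPolynomial.monomial (expOf A) (μ A)

/-- A point process is strongly Rayleigh if its probability generating
polynomial is real stable. -/
def StronglyRayleigh {n : ℕ} (μ : Finset (Fin n) → ℝ) : Prop :=
  IsPointProcess μ ∧ RealStable (genPoly μ)

/-- `ℙ(A ⊆ 𝔛)`. -/
noncomputable def probSupset {n : ℕ} (μ : Finset (Fin n) → ℝ) (A : Finset (Fin n)) : ℝ :=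
  ∑ B ∈ Finset.univ.filter (fun B : Finset (Fin n) => A ⊆ B), μ B

/-- The kernel polynomial `g_𝔛(z) = Σ_A (−1)^{|A|} ℙ(A ⊆ 𝔛) z^{A^c}`. -/
noncomputable def kernelPoly {n : ℕ} (μ : Finset (Fin n) → ℝ) : MvPolynomial (Fin n) ℝ :=
  ∑ A : Finset (Fin n),
    MvPolynomial.monomial (expOf Aᶜ) ((-1 : ℝ) ^ A.card * probSupset μ A)

open Filter Topology

/-- The multi-affine function `∑_{A ⊆ S} c_A ∏_{i ∈ A} x_i`. -/
def maEval {ι R : Type*} [CommRing R] (S : Finset ι) (c : Finset ι → R) (x : ι → R) : R :=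
  ∑ A ∈ S.powerset, c A * ∏ i ∈ A, x i

/-- The diagonalization of a multi-affine function, as a univariate polynomial. -/
noncomputable def maDiag {ι : Type*} (S : Finset ι) (c : Finset ι → ℝ) : Polynomial ℝ :=
  ∑ A ∈ S.powerset, Polynomial.C (c A) * Polynomial.X ^ A.card

lemma maEval_congr {ι R : Type*} [CommRing R] {S : Finset ι} (c : Finset ι → R) {x y : ι → R} (h : ∀ i ∈ S, x i = y i) :
    maEval S c x = maEval S c y := by
  refine Finset.sum_congr rfl fun A hA => ?_
  rw [Finset.prod_congr rfl fun i hi => h i (Finset.mem_powerset.1 hA hi)]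

lemma eval_maDiag {ι : Type*} (S : Finset ι) (c : Finset ι → ℝ) (t : ℝ) :
    (maDiag S c).eval t = maEval S c fun _ => t := by
  simp [maDiag, maEval, Polynomial.eval_finsetSum]

lemma maEval_ofReal {ι : Type*} (S : Finset ι) (c : Finset ι → ℝ) (x : ι → ℝ) :
    maEval S (fun A => (c A : ℂ)) (fun i => (x i : ℂ)) = (maEval S c x : ℝ) := by
  simp [maEval]

section MultiAffineFunctions

variable {ι R : Type*} [DecidableEq ι] [CommRing R]

lemma maEval_insert {S : Finset ι} {a : ι} (ha : a ∉ S) (c : Finset ι → R) (x : ι → R) :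
    maEval (insert a S) c x =
      maEval S c x + x a * maEval S (fun A => c (insert a A)) x := by
  unfold maEval
  rw [Finset.sum_powerset_insert ha, Finset.mul_sum]
  congr 1
  refine Finset.sum_congr rfl fun A hA => ?_
  rw [Finset.prod_insert fun h => ha (Finset.mem_powerset.1 hA h)]
  ring

lemma maEval_insert_update {S : Finset ι} {a : ι} (ha : a ∉ S) (c : Finset ι → R) (x : ι → R)
    (t : R) : maEval (insert a S) c (Function.update x a t) =
      maEval S c x + t * maEval S (fun A => c (insert a A)) x := by
  have h : ∀ i ∈ S, Function.update x a t i = x i := fun i hi =>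
    Function.update_of_ne (by rintro rfl; exact ha hi) _ _
  rw [maEval_insert ha, maEval_congr c h, maEval_congr _ h, Function.update_self]

lemma maDiag_insert {S : Finset ι} {a : ι} (ha : a ∉ S) (c : Finset ι → ℝ) :
    maDiag (insert a S) c = maDiag S c + Polynomial.X * maDiag S (fun A => c (insert a A)) := by
  unfold maDiag
  rw [Finset.sum_powerset_insert ha, Finset.mul_sum]
  congr 1
  refine Finset.sum_congr rfl fun A hA => ?_
  rw [Finset.card_insert_of_notMem fun h => ha (Finset.mem_powerset.1 hA h)]
  ring

lemma derivative_maDiag (S : Finset ι) (c : Finset ι → ℝ) :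
    Polynomial.derivative (maDiag S c) =
      ∑ i ∈ S, maDiag (S.erase i) (fun A => c (insert i A)) := by
  induction S using Finset.induction_on generalizing c with
  | empty => simp [maDiag]
  | insert a S ha ih =>
    rw [maDiag_insert ha, Polynomial.derivative_add, Polynomial.derivative_mul, ih, ih,
      Finset.sum_insert ha, Finset.erase_insert ha, Polynomial.derivative_X, one_mul,
      Finset.mul_sum, add_left_comm, ← Finset.sum_add_distrib]
    congr 1
    refine Finset.sum_congr rfl fun i hi => ?_
    have hia : i ≠ a := by rintro rfl; exact ha hi
    rw [Finset.erase_insert_of_ne hia.symm,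
      maDiag_insert fun h => ha (Finset.mem_of_mem_erase h)]
    simp only [Finset.insert_comm a i]

/-- The Rayleigh inequalities `f · ∂ᵢ∂ⱼf ≤ ∂ᵢf · ∂ⱼf` for a multi-affine function, written in the
form obtained by setting the variables `i` and `j` to zero (on which they do not depend). -/
def IsRayleigh (S : Finset ι) (c : Finset ι → ℝ) : Prop :=
  ∀ (i j : ι) (T : Finset ι), i ≠ j → i ∉ T → j ∉ T → insert i (insert j T) = S →
    ∀ x : ι → ℝ, maEval T c x * maEval T (fun A => c (insert i (insert j A))) x ≤
      maEval T (fun A => c (insert i A)) x * maEval T (fun A => c (insert j A)) x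

lemma IsRayleigh.of_insert {S : Finset ι} {a : ι} (ha : a ∉ S) {c : Finset ι → ℝ}
    (h : IsRayleigh (insert a S) c) :
    IsRayleigh S c ∧ IsRayleigh S (fun A => c (insert a A)) := by
  have key : ∀ (i j : ι) (T : Finset ι), i ≠ j → i ∉ T → j ∉ T → insert i (insert j T) = S →
      ∀ (x : ι → ℝ) (t : ℝ),
      (maEval T c x + t * maEval T (fun A => c (insert a A)) x) *
        (maEval T (fun A => c (insert i (insert j A))) x +
          t * maEval T (fun A => c (insert i (insert j (insert a A)))) x) ≤
      (maEval T (fun A => c (insert i A)) x + t * maEval T (fun A => c (insert i (insert a A))) x) *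
        (maEval T (fun A => c (insert j A)) x +
          t * maEval T (fun A => c (insert j (insert a A))) x) := by
    rintro i j T hij hi hj rfl x t
    simp only [Finset.mem_insert, not_or] at ha
    have := h i j (insert a T) hij (by simp [hi, Ne.symm ha.1]) (by simp [hj, Ne.symm ha.2.1])
      (by rw [Finset.insert_comm j a, Finset.insert_comm i a]) (Function.update x a t)
    simpa only [maEval_insert_update ha.2.2] using this
  refine ⟨fun i j T hij hi hj hS x => by simpa using key i j T hij hi hj hS x 0,
    fun i j T hij hi hj hS x => ?_⟩
  have := key i j T hij hi hj hS x
  simp only [Finset.insert_comm a i, Finset.insert_comm a j]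
  generalize maEval T c x = a₀, maEval T (fun A => c (insert a A)) x = a₁,
    maEval T (fun A => c (insert i (insert j A))) x = d₀,
    maEval T (fun A => c (insert i (insert j (insert a A)))) x = d₁,
    maEval T (fun A => c (insert i A)) x = b₀,
    maEval T (fun A => c (insert i (insert a A))) x = b₁,
    maEval T (fun A => c (insert j A)) x = e₀,
    maEval T (fun A => c (insert j (insert a A))) x = e₁ at this ⊢
  by_contra! hlt
  set δ := a₁ * d₁ - b₁ * e₁ with hδ
  set β := a₀ * d₁ + a₁ * d₀ - b₀ * e₁ - b₁ * e₀ with hβ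
  set γ := a₀ * d₀ - b₀ * e₀ with hγ
  have hδ0 : 0 < δ := by linarith
  have hq : ∀ t : ℝ, δ * t ^ 2 + β * t + γ ≤ 0 := fun t => by
    have := this t
    rw [hδ, hβ, hγ]; linarith
  have h1 := hq ((|β| + |γ| + 1) / δ + 1)
  have hβ' := neg_abs_le β
  have hγ' := neg_abs_le γ
  set s := (|β| + |γ| + 1) / δ + 1 with hs
  have hs1 : 1 ≤ s := by
    have : 0 ≤ (|β| + |γ| + 1) / δ := by positivity
    linarith
  have hs2 : δ * s = |β| + |γ| + 1 + δ := by rw [hs]; field_simp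
  have : δ * s ^ 2 = (|β| + |γ| + 1 + δ) * s := by rw [← hs2]; ring
  nlinarith [mul_nonneg (abs_nonneg γ) (sub_nonneg.2 hs1),
    mul_nonneg (sub_nonneg.2 hβ') (sub_nonneg.2 (zero_le_one.trans hs1))]

lemma IsRayleigh.wronskian_nonneg {S : Finset ι} {a : ι} (ha : a ∉ S) {c : Finset ι → ℝ}
    (h : IsRayleigh (insert a S) c) (t : ℝ) :
    0 ≤ (maDiag S (fun A => c (insert a A))).eval t * (maDiag S c).derivative.eval t -
      (maDiag S c).eval t * (maDiag S (fun A => c (insert a A))).derivative.eval t := by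
  simp only [derivative_maDiag, Polynomial.eval_finsetSum, Finset.mul_sum,
    ← Finset.sum_sub_distrib, eval_maDiag]
  refine Finset.sum_nonneg fun i hi => ?_
  have hia : i ≠ a := by rintro rfl; exact ha hi
  have hT : i ∉ S.erase i := Finset.notMem_erase i S
  have := h a i (S.erase i) hia.symm (fun h => ha (Finset.mem_of_mem_erase h)) hT
    (by rw [Finset.insert_erase hi]) fun _ => t
  have e : ∀ c' : Finset ι → ℝ, maEval S c' (fun _ => t) = maEval (S.erase i) c' (fun _ => t) +
      t * maEval (S.erase i) (fun A => c' (insert i A)) (fun _ => t) := fun c' => by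
    conv_lhs => rw [← Finset.insert_erase hi]
    rw [maEval_insert hT]
  rw [e c, e fun A => c (insert a A)]
  nlinarith

end MultiAffineFunctions

lemma Polynomial.eq_zero_of_eval_eq_zero_Ioo {p : Polynomial ℝ} {a b : ℝ} (hab : a < b)
    (h : ∀ t ∈ Set.Ioo a b, p.eval t = 0) : p = 0 :=
  Polynomial.eq_zero_of_infinite_isRoot p ((Set.Ioo_infinite hab).mono h)

lemma monotoneOn_eval_div {p q : Polynomial ℝ} {s : Set ℝ} (hs : Convex ℝ s)
    (hq : ∀ t ∈ s, q.eval t ≠ 0)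
    (hW : ∀ t, 0 ≤ q.eval t * p.derivative.eval t - p.eval t * q.derivative.eval t) :
    MonotoneOn (fun t => p.eval t / q.eval t) s := by
  refine monotoneOn_of_hasDerivWithinAt_nonneg hs
    (p.continuous.continuousOn.div q.continuous.continuousOn hq)
    (fun t ht => ((p.hasDerivAt t).div (q.hasDerivAt t)
      (hq t (interior_subset ht))).hasDerivWithinAt) fun t _ => ?_
  have := hW t
  exact div_nonneg (by linarith) (sq_nonneg _)

lemma eq_zero_or_pos_of_wronskian_nonneg {p q : Polynomial ℝ}
    (hW : ∀ t, 0 ≤ q.eval t * p.derivative.eval t - p.eval t * q.derivative.eval t)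
    (hpos : ∀ t, 0 < t → 0 < p.eval t + t * q.eval t) :
    (q = 0 ∨ ∀ t, 0 < t → 0 < q.eval t) ∧ (p = 0 ∨ ∀ t, 0 < t → 0 < p.eval t) := by
  have hanti : MonotoneOn (fun t => (-q).eval t / (p + Polynomial.X * q).eval t)
      (Set.Ioi 0) := by
    refine monotoneOn_eval_div (convex_Ioi 0) (fun t ht => ?_) fun t => ?_
    · simpa using (hpos t ht).ne'
    · have := hW t
      simp
      nlinarith [sq_nonneg (q.eval t)]
  have hnn : ∀ t, 0 < t → 0 ≤ q.eval t := by
    by_contra! ⟨t₀, ht₀, hneg⟩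
    have hneg' : ∀ t ∈ Set.Ici t₀, q.eval t < 0 := fun t ht => by
      have ht' : 0 < t := ht₀.trans_le ht
      have := hanti ht₀ ht' ht
      have h0 : 0 < (-q).eval t₀ / (p + Polynomial.X * q).eval t₀ :=
        div_pos (by simpa using hneg) (by simpa using hpos t₀ ht₀)
      have h1 := (div_pos_iff_of_pos_right (by simpa using hpos t ht')).1 (h0.trans_le this)
      simpa using h1
    have hmono := monotoneOn_eval_div (convex_Ici t₀) (fun t ht => (hneg' t ht).ne) hW
    set r := p.eval t₀ / q.eval t₀ with hr
    set t := max t₀ (-r) with ht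
    have htm : t ∈ Set.Ici t₀ := Set.mem_Ici.2 (le_max_left t₀ (-r))
    have h1 : r ≤ p.eval t / q.eval t := hmono (Set.self_mem_Ici) htm htm
    have h2 := hpos t (ht₀.trans_le htm)
    have h3 := hneg' t htm
    rw [le_div_iff_of_neg h3] at h1
    nlinarith [le_max_right t₀ (-r)]
  by_cases hq : ∃ t₀, 0 < t₀ ∧ q.eval t₀ = 0
  · obtain ⟨t₀, ht₀, hz⟩ := hq
    have hq0 : q = 0 := by
      refine Polynomial.eq_zero_of_eval_eq_zero_Ioo (lt_add_one t₀) fun t ht => ?_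
      have ht' : 0 < t := ht₀.trans ht.1
      have := hanti ht₀ ht' ht.1.le
      simp only [Polynomial.eval_neg, hz, neg_zero, zero_div] at this
      have hp : 0 < (p + Polynomial.X * q).eval t := by simpa using hpos t ht'
      have h1 := (le_div_iff₀ hp).1 this
      linarith [hnn t ht']
    subst hq0
    exact ⟨Or.inl rfl, Or.inr fun t ht => by simpa using hpos t ht⟩
  · push Not at hq
    have hqpos : ∀ t, 0 < t → 0 < q.eval t := fun t ht => (hnn t ht).lt_of_ne' (hq t ht)
    refine ⟨Or.inr hqpos, ?_⟩
    have hmono := monotoneOn_eval_div (convex_Ioi 0) (fun t ht => (hqpos t ht).ne') hW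
    have hpn : ∀ t, 0 < t → 0 ≤ p.eval t / q.eval t := fun t ht => by
      by_contra! hlt
      set r := p.eval t / q.eval t with hr
      set s := min t (-r) with hs
      have hs0 : 0 < s := lt_min ht (by linarith)
      have h1 : p.eval s / q.eval s ≤ r := hmono hs0 ht (min_le_left _ _)
      rw [div_le_iff₀ (hqpos s hs0)] at h1
      nlinarith [hpos s hs0, hqpos s hs0, min_le_right t (-r)]
    by_cases hp : ∃ t₀, 0 < t₀ ∧ p.eval t₀ = 0
    · obtain ⟨t₀, ht₀, hz⟩ := hp
      refine Or.inl (Polynomial.eq_zero_of_eval_eq_zero_Ioo ht₀ fun t ht => ?_)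
      have h1 : p.eval t / q.eval t ≤ p.eval t₀ / q.eval t₀ := hmono ht.1 ht₀ ht.2.le
      rw [hz, zero_div] at h1
      simpa [(hqpos t ht.1).ne'] using le_antisymm h1 (hpn t ht.1)
    · push Not at hp
      refine Or.inr fun t ht => ?_
      have h1 : 0 ≤ p.eval t := by
        simpa [(hqpos t ht).ne'] using mul_nonneg (hpn t ht) (hqpos t ht).le
      exact h1.lt_of_ne' (hp t ht)

section Positivity

variable {ι : Type*} [DecidableEq ι]

lemma Finset.forall_subset_insert {S : Finset ι} {a : ι} {P : Finset ι → Prop}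
    (h₁ : ∀ A ⊆ S, P A) (h₂ : ∀ A ⊆ S, P (insert a A)) :
    ∀ A ⊆ insert a S, P A := fun A hA => by
  by_cases haA : a ∈ A
  · rw [← Finset.insert_erase haA]
    exact h₂ _ (Finset.subset_insert_iff.1 hA)
  · exact h₁ A ((Finset.subset_insert_iff_of_notMem haA).1 hA)

lemma IsRayleigh.eq_zero_of_maDiag_eq_zero {S : Finset ι} {c : Finset ι → ℝ}
    (h : IsRayleigh S c) (h0 : maDiag S c = 0) : ∀ A ⊆ S, c A = 0 := by
  induction S using Finset.induction_on generalizing c with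
  | empty => simpa [maDiag] using h0
  | insert a S ha ih =>
    have hW := h.wronskian_nonneg ha
    rw [maDiag_insert ha] at h0
    have hp : maDiag S c = -(Polynomial.X * maDiag S (fun A => c (insert a A))) :=
      eq_neg_of_add_eq_zero_left h0
    have hq : maDiag S (fun A => c (insert a A)) = 0 := by
      refine Polynomial.eq_zero_of_eval_eq_zero_Ioo zero_lt_one fun t _ => ?_
      have := hW t
      rw [hp] at this
      simp at this
      nlinarith
    rw [hq, mul_zero, neg_zero] at hp
    obtain ⟨h₁, h₂⟩ := h.of_insert ha
    exact Finset.forall_subset_insert (ih h₁ hp) (ih h₂ hq)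

/-- A Rayleigh multi-affine function which is positive on the positive diagonal has nonnegative
coefficients. -/
lemma IsRayleigh.nonneg_of_maDiag_pos {S : Finset ι} {c : Finset ι → ℝ}
    (h : IsRayleigh S c) (hpos : ∀ t, 0 < t → 0 < (maDiag S c).eval t) :
    ∀ A ⊆ S, 0 ≤ c A := by
  induction S using Finset.induction_on generalizing c with
  | empty => simpa [maDiag] using (hpos 1 one_pos).le
  | insert a S ha ih =>
    obtain ⟨h₁, h₂⟩ := h.of_insert ha
    have key := eq_zero_or_pos_of_wronskian_nonneg (h.wronskian_nonneg ha) fun t ht => by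
      simpa [maDiag_insert ha] using hpos t ht
    refine Finset.forall_subset_insert ?_ ?_
    · rcases key.2 with h0 | h0
      · exact fun A hA => (h₁.eq_zero_of_maDiag_eq_zero h0 A hA).ge
      · exact ih h₁ h0
    · rcases key.1 with h0 | h0
      · exact fun A hA => (h₂.eq_zero_of_maDiag_eq_zero h0 A hA).ge
      · exact ih h₂ h0

/-- A multi-affine function without zeros in the product of upper half planes satisfies the
Rayleigh inequalities. -/
lemma isRayleigh_of_ne_zero {S : Finset ι} {c : Finset ι → ℝ}
    (h : ∀ z : ι → ℂ, (∀ i, 0 < (z i).im) → maEval S (fun A => (c A : ℂ)) z ≠ 0) :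
    IsRayleigh S c := by
  rintro i j T hij hi hj rfl x
  by_contra! hlt
  let z : ℝ → ι → ℂ := fun ε k => x k + ε * Complex.I
  have hcont : ∀ c' : Finset ι → ℂ, Continuous fun ε => maEval T c' (z ε) := fun c' => by
    unfold maEval
    fun_prop
  have hz0 : ∀ c' : Finset ι → ℝ,
      maEval T (fun A => (c' A : ℂ)) (z 0) = (maEval T c' x : ℝ) := fun c' => by
    rw [← maEval_ofReal]
    simp [z]
  set num : ℝ → ℂ := fun ε => maEval T (fun A => (c A : ℂ)) (z ε) +
    Complex.I * maEval T (fun A => (c (insert i A) : ℂ)) (z ε) with hnum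
  set den : ℝ → ℂ := fun ε => maEval T (fun A => (c (insert j A) : ℂ)) (z ε) +
    Complex.I * maEval T (fun A => (c (insert i (insert j A)) : ℂ)) (z ε) with hden
  have hnc : Continuous num := (hcont _).add (continuous_const.mul (hcont _))
  have hdc : Continuous den := (hcont _).add (continuous_const.mul (hcont _))
  have hn0 : num 0 = (maEval T c x : ℝ) + Complex.I *
      (maEval T (fun A => c (insert i A)) x : ℝ) := by
    simp only [hnum, ← hz0]
  have hd0 : den 0 = (maEval T (fun A => c (insert j A)) x : ℝ) + Complex.I *
      (maEval T (fun A => c (insert i (insert j A))) x : ℝ) := by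
    simp only [hden, ← hz0]
  generalize maEval T c x = α, maEval T (fun A => c (insert i A)) x = β,
    maEval T (fun A => c (insert j A)) x = γ,
    maEval T (fun A => c (insert i (insert j A))) x = δ at hlt hn0 hd0
  have hden0 : den 0 ≠ 0 := fun h0 => by
    rw [hd0] at h0
    have h1 : γ = 0 := by simpa using congrArg Complex.re h0
    have h2 : δ = 0 := by simpa using congrArg Complex.im h0
    simp [h1, h2] at hlt
  have him : 0 < (-(num 0 / den 0)).im := by
    have hN : 0 < Complex.normSq (den 0) := Complex.normSq_pos.2 hden0
    have : (-(num 0 / den 0)).im = (α * δ - β * γ) / Complex.normSq (den 0) := by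
      rw [Complex.neg_im, Complex.div_im, hn0, hd0]
      simp
      ring
    rw [this]
    exact div_pos (by linarith) hN
  have hct : ContinuousAt (fun ε => (-(num ε / den ε)).im) 0 :=
    Complex.continuous_im.continuousAt.comp (hnc.continuousAt.div hdc.continuousAt hden0).neg
  have ev : ∀ᶠ ε in 𝓝[>] (0 : ℝ), 0 < (-(num ε / den ε)).im ∧ den ε ≠ 0 ∧ 0 < ε :=
    ((hct.eventually (lt_mem_nhds him)).filter_mono nhdsWithin_le_nhds).and
      (((hdc.continuousAt.eventually_ne hden0).filter_mono nhdsWithin_le_nhds).and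
        self_mem_nhdsWithin)
  obtain ⟨ε, h1, h2, h3⟩ := ev.exists
  refine h (Function.update (Function.update (z ε) j (-(num ε / den ε))) i Complex.I)
    (fun k => ?_) ?_
  · by_cases hk : k = i
    · subst hk; simp
    · by_cases hk' : k = j
      · subst hk'; simpa [hk] using h1
      · simpa [hk, hk', z] using h3
  · rw [maEval_insert_update (by simp [hij, hi]), maEval_insert_update hj,
      maEval_insert_update hj]
    have : num ε + -(num ε / den ε) * den ε = 0 := by field_simp; ring
    rw [← this]
    simp only [hnum, hden]
    ring

end Positivity
section MvPolynomials

variable {n : ℕ}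

lemma expOf_apply (A : Finset (Fin n)) (i : Fin n) : expOf A i = if i ∈ A then 1 else 0 := by
  simp [expOf, Finsupp.single_apply]

lemma expOf_injective : Function.Injective (expOf (n := n)) := fun A B h => by
  ext i
  have := DFunLike.congr_fun h i
  rw [expOf_apply, expOf_apply] at this
  by_cases hA : i ∈ A <;> by_cases hB : i ∈ B <;> simp_all

lemma monomial_expOf (A : Finset (Fin n)) (a : ℝ) :
    MvPolynomial.monomial (expOf A) a = MvPolynomial.C a * ∏ i ∈ A, MvPolynomial.X i := by
  rw [expOf, MvPolynomial.monomial_sum_index]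
  rfl

lemma MultiAffine.eq_sum {g : MvPolynomial (Fin n) ℝ} (hg : MultiAffine g) :
    g = ∑ A : Finset (Fin n), MvPolynomial.monomial (expOf A) (g.coeff (expOf A)) := by
  have hsub : g.support ⊆ Finset.univ.image (expOf (n := n)) := fun m hm => by
    refine Finset.mem_image.2 ⟨m.support, Finset.mem_univ _, ?_⟩
    ext i
    have h1 : m i ≤ 1 := (MvPolynomial.degreeOf_le_iff.1 (hg i)) m hm
    rw [expOf_apply]
    by_cases hi : m i = 0
    · simp [hi]
    · simp [hi]; omega
  conv_lhs => rw [g.as_sum, Finset.sum_subset hsub fun m _ hm => by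
    rw [MvPolynomial.notMem_support_iff.1 hm, MvPolynomial.monomial_zero]]
  exact Finset.sum_image fun A _ B _ h => expOf_injective h

lemma coeff_univ_kernelPoly (μ : Finset (Fin n) → ℝ) :
    (kernelPoly μ).coeff (expOf Finset.univ) = ∑ A, μ A := by
  rw [kernelPoly, MvPolynomial.coeff_sum, Finset.sum_eq_single ∅]
  · simp [probSupset, MvPolynomial.coeff_sum]
  · intro A _ hA
    rw [MvPolynomial.coeff_monomial, if_neg fun h => hA ?_]
    simpa using expOf_injective h
  · simp

/-- The expansion of `∏_{i ∈ B} (Xᵢ - 1) ∏_{i ∉ B} Xᵢ` in monomials. -/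
lemma prod_sub_one_mul_prod_compl (B : Finset (Fin n)) :
    (∏ i ∈ B, (MvPolynomial.X i - 1 : MvPolynomial (Fin n) ℝ)) * ∏ i ∈ Bᶜ, MvPolynomial.X i =
      ∑ A ∈ B.powerset, (-1) ^ A.card * ∏ i ∈ Aᶜ, MvPolynomial.X i := by
  simp only [sub_eq_neg_add, Finset.prod_add, Finset.prod_const, Finset.sum_mul]
  refine Finset.sum_congr rfl fun A hA => ?_
  have hA := Finset.mem_powerset.1 hA
  rw [mul_assoc, ← Finset.prod_union]
  · congr 2
    ext i
    have := @hA i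
    simp only [Finset.mem_union, Finset.mem_sdiff, Finset.mem_compl]
    tauto
  · exact Finset.disjoint_left.2 fun i hi hi' =>
      Finset.mem_compl.1 hi' (Finset.mem_sdiff.1 hi).1

/-- The expansion of a monomial in the products `∏_{i ∈ C} (Xᵢ - 1) ∏_{i ∉ C} Xᵢ`. -/
lemma prod_X_eq_sum (A : Finset (Fin n)) :
    (∏ i ∈ A, MvPolynomial.X i : MvPolynomial (Fin n) ℝ) =
      ∑ C ∈ Aᶜ.powerset, (-1) ^ C.card *
        ((∏ i ∈ C, (MvPolynomial.X i - 1)) * ∏ i ∈ Cᶜ, MvPolynomial.X i) := by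
  have h : (∏ i ∈ Aᶜ, (-(MvPolynomial.X i - 1) + MvPolynomial.X i) :
      MvPolynomial (Fin n) ℝ) = 1 := by simp
  conv_lhs => rw [← mul_one (∏ i ∈ A, _), ← h, Finset.prod_add, Finset.mul_sum]
  refine Finset.sum_congr rfl fun C hC => ?_
  have hC := Finset.mem_powerset.1 hC
  have hu : Cᶜ = A ∪ (Aᶜ \ C) := by
    ext i
    have := @hC i
    simp only [Finset.mem_union, Finset.mem_sdiff, Finset.mem_compl] at *
    tauto
  rw [Finset.prod_neg, hu, Finset.prod_union]
  · ring
  · exact Finset.disjoint_left.2 fun i hi hi' =>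
      Finset.mem_compl.1 (Finset.mem_sdiff.1 hi').1 hi

lemma kernelPoly_eq_sum (μ : Finset (Fin n) → ℝ) :
    kernelPoly μ = ∑ B : Finset (Fin n), MvPolynomial.C (μ B) *
      ((∏ i ∈ B, (MvPolynomial.X i - 1)) * ∏ i ∈ Bᶜ, MvPolynomial.X i) := by
  simp only [prod_sub_one_mul_prod_compl, Finset.mul_sum, kernelPoly, monomial_expOf, probSupset,
    map_mul, map_sum]
  rw [Finset.sum_comm' (t' := Finset.univ) (s' := fun B => B.powerset) (by simp)]
  refine Finset.sum_congr rfl fun B _ => Finset.sum_congr rfl fun A _ => ?_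
  simp
  ring

lemma MultiAffine.exists_kernelPoly_eq {g : MvPolynomial (Fin n) ℝ} (hg : MultiAffine g) :
    ∃ μ : Finset (Fin n) → ℝ, kernelPoly μ = g := by
  refine ⟨fun C => ∑ A ∈ Cᶜ.powerset, (-1) ^ C.card * g.coeff (expOf A), ?_⟩
  conv_rhs => rw [hg.eq_sum]
  simp only [kernelPoly_eq_sum, monomial_expOf, map_sum, Finset.sum_mul]
  conv_rhs =>
    enter [2, A]
    rw [prod_X_eq_sum, Finset.mul_sum]
  rw [Finset.sum_comm' (t' := Finset.univ) (s' := fun A => Aᶜ.powerset)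
    (by simp [Finset.subset_compl_comm])]
  refine Finset.sum_congr rfl fun A _ => Finset.sum_congr rfl fun C _ => ?_
  simp
  ring

lemma sum_mul_prod_eq {R : Type*} [CommRing R] (c : Finset (Fin n) → R) {z w : Fin n → R}
    (h : ∀ i, w i - 1 = z i * w i) :
    ∑ B : Finset (Fin n), c B * ((∏ i ∈ B, (w i - 1)) * ∏ i ∈ Bᶜ, w i) =
      (∏ i, w i) * maEval Finset.univ c z := by
  rw [maEval, Finset.powerset_univ, Finset.mul_sum]
  refine Finset.sum_congr rfl fun B _ => ?_
  simp only [h, Finset.prod_mul_distrib]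
  rw [← Finset.prod_mul_prod_compl B w]
  ring

lemma eval_map_kernelPoly (μ : Finset (Fin n) → ℝ) {z w : Fin n → ℂ}
    (h : ∀ i, w i - 1 = z i * w i) :
    MvPolynomial.eval w (MvPolynomial.map (algebraMap ℝ ℂ) (kernelPoly μ)) =
      (∏ i, w i) * maEval Finset.univ (fun A => (μ A : ℂ)) z := by
  rw [← sum_mul_prod_eq _ h, kernelPoly_eq_sum]
  simp

lemma eval_diagPoly_kernelPoly (μ : Finset (Fin n) → ℝ) {t x : ℝ} (h : x - 1 = t * x) :
    (diagPoly (kernelPoly μ)).eval x = x ^ n * (maDiag Finset.univ μ).eval t := by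
  have := sum_mul_prod_eq μ (z := fun _ => t) (w := fun _ => x) fun _ => h
  rw [eval_maDiag, ← Fin.prod_const, ← this, kernelPoly_eq_sum, diagPoly]
  simp [Polynomial.eval_finsetSum]

lemma eval_map_genPoly (μ : Finset (Fin n) → ℝ) (z : Fin n → ℂ) :
    MvPolynomial.eval z (MvPolynomial.map (algebraMap ℝ ℂ) (genPoly μ)) =
      maEval Finset.univ (fun A => (μ A : ℂ)) z := by
  simp [genPoly, maEval, monomial_expOf]

lemma IsPointProcess.maDiag_pos {μ : Finset (Fin n) → ℝ} (hμ : IsPointProcess μ) {t : ℝ}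
    (ht : 0 < t) : 0 < (maDiag Finset.univ μ).eval t := by
  rw [eval_maDiag, maEval, Finset.powerset_univ]
  have hnn : ∀ A ∈ Finset.univ, 0 ≤ μ A * ∏ _i ∈ A, t := fun A _ =>
    mul_nonneg (hμ.1 A) (Finset.prod_nonneg fun _ _ => ht.le)
  obtain ⟨A, hA, hA'⟩ : ∃ A ∈ Finset.univ, μ A ≠ 0 :=
    Finset.exists_ne_zero_of_sum_ne_zero (by rw [hμ.2]; exact one_ne_zero)
  exact Finset.sum_pos' hnn ⟨A, hA, mul_pos ((hμ.1 A).lt_of_ne' hA')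
    (Finset.prod_pos fun _ _ => ht)⟩

lemma realStable_genPoly {μ : Finset (Fin n) → ℝ} (h : RealStable (kernelPoly μ)) :
    RealStable (genPoly μ) := fun z hz h0 => by
  have hz1 : ∀ i, 1 - z i ≠ 0 := fun i hi => by
    have := congrArg Complex.im hi
    simp at this
    exact (hz i).ne' this
  refine h (fun i => (1 - z i)⁻¹) (fun i => ?_) ?_
  · rw [Complex.inv_im]
    exact div_pos (by simpa using hz i) (Complex.normSq_pos.2 (hz1 i))
  · rw [eval_map_kernelPoly μ (z := z) fun i => by have := hz1 i; field_simp; ring,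
      ← eval_map_genPoly, h0, mul_zero]

end MvPolynomials

theorem stmt16 (n : ℕ) (g : MvPolynomial (Fin n) ℝ)
    (hstable : RealStable g) (hma : MultiAffine g) :
    (∃ μ : Finset (Fin n) → ℝ, StronglyRayleigh μ ∧ kernelPoly μ = g) ↔
      (MvPolynomial.coeff (expOf (Finset.univ : Finset (Fin n))) g = 1 ∧
        ∀ x : ℝ, (diagPoly g).IsRoot x → x ∈ Set.Icc (0 : ℝ) 1) := by
  constructor
  · rintro ⟨μ, ⟨hμ, -⟩, rfl⟩
    refine ⟨by rw [coeff_univ_kernelPoly, hμ.2], fun x hx => ?_⟩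
    by_contra hx'
    have hx0 : x ≠ 0 := by rintro rfl; simp at hx'
    have ht : 0 < 1 - x⁻¹ := by
      rcases hx0.lt_or_gt with h | h
      · linarith [inv_lt_zero.2 h]
      · have : 1 < x := by
          by_contra! h1
          exact hx' ⟨h.le, h1⟩
        linarith [inv_lt_one_of_one_lt₀ this]
    rw [Polynomial.IsRoot,
      eval_diagPoly_kernelPoly μ (t := 1 - x⁻¹) (by field_simp)] at hx
    exact mul_ne_zero (pow_ne_zero n hx0) (hμ.maDiag_pos ht).ne' hx
  · rintro ⟨hcoeff, hroots⟩
    obtain ⟨μ, rfl⟩ := hma.exists_kernelPoly_eq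
    rw [coeff_univ_kernelPoly] at hcoeff
    have hgen := realStable_genPoly hstable
    have hone : (maDiag Finset.univ μ).eval 1 = 1 := by
      simpa [eval_maDiag, maEval] using hcoeff
    have hne : ∀ t, 0 < t → (maDiag Finset.univ μ).eval t ≠ 0 := fun t ht h0 => by
      by_cases ht1 : t = 1
      · rw [ht1, hone] at h0
        exact one_ne_zero h0
      · have h1t : 1 - t ≠ 0 := sub_ne_zero.2 (Ne.symm ht1)
        have hx := hroots (1 - t)⁻¹ <| by
          rw [Polynomial.IsRoot,
            eval_diagPoly_kernelPoly μ (t := t) (by field_simp; ring), h0, mul_zero]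
        rcases h1t.lt_or_gt with h | h
        · linarith [inv_lt_zero.2 h, hx.1]
        · linarith [(one_lt_inv₀ h).2 (by linarith), hx.2]
    have hpos : ∀ t, 0 < t → 0 < (maDiag Finset.univ μ).eval t := fun t ht => by
      by_contra! hle
      obtain ⟨s, hs, hs0⟩ := (convex_Ioi (0 : ℝ)).isPreconnected.intermediate_value
        (Set.mem_Ioi.2 ht) (Set.mem_Ioi.2 one_pos)
        (maDiag Finset.univ μ).continuous.continuousOn
        (show (0 : ℝ) ∈ Set.Icc _ _ from ⟨hle, by rw [hone]; exact zero_le_one⟩)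
      exact hne s hs hs0
    have hray : IsRayleigh Finset.univ μ := isRayleigh_of_ne_zero fun z hz => by
      rw [← eval_map_genPoly]
      exact hgen z hz
    exact ⟨μ, ⟨⟨fun A => hray.nonneg_of_maDiag_pos hpos A (Finset.subset_univ A), hcoeff⟩,
      hgen⟩, rfl⟩
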